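/- arXiv:2409.06977 — 4 statements merged into one kernel-verified Lean document; each statement's English description precedes it below -/
import Mathlib

section
/- Let Q be a preorder, (P,c) a Q-poset, v ∈ P, and u an element of the unfolding u(P) whose last element is v. Then the Q-posets u(P↾v) and u(P)↾u are isomorphic, i.e., there is an order isomorphism between them that preserves labels. -/
/-- An element of the unfolding `u(P)` of a poset `P`: a finite covering chain
`v₁ v₂ … v_t` in `P` (represented as a list) such that `v₁` is a minimal element
of `P` and each `v_{i+1}` is an immediate successor (cover) of `v_i`. -/
def IsUChain {P : Type*} [PartialOrder P] (l : List P) : Prop :=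
  l ≠ [] ∧ (∀ x ∈ l.head?, IsMin x) ∧ l.Chain' (· ⋖ ·)

/-- The underlying set of the unfolding `u(P)` of a poset `P`. -/
def Unf (P : Type*) [PartialOrder P] : Type _ := {l : List P // IsUChain l}

/-- The unfolding is ordered by the prefix relation on covering chains. -/
instance {P : Type*} [PartialOrder P] : PartialOrder (Unf P) where
  le a b := a.1 <+: b.1
  le_refl a := List.prefix_refl a.1
  le_trans _ _ _ hab hbc := List.IsPrefix.trans hab hbc
  le_antisymm a b hab hba :=
    Subtype.ext (hab.eq_of_length (Nat.le_antisymm hab.length_le hba.length_le))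

/-- The last element of a covering chain. -/
def lastOf {P : Type*} [PartialOrder P] (l : Unf P) : P := l.1.getLast l.2.1

/-- The labeling of the unfolding `u(P)` induced by a labeling `c` of `P`:
a chain is labeled by the label of its last element. -/
def unfLabel {P Q : Type*} [PartialOrder P] (c : P → Q) (l : Unf P) : Q := c (lastOf l)

/-- The `h`-preorder: `Hle cA cB` holds iff there is a morphism of `Q`-posets,
i.e. a monotone map `f` with `cA x ≤ cB (f x)` for all `x`. -/
def Hle {A B Q : Type*} [Preorder A] [Preorder B] [Preorder Q]
    (cA : A → Q) (cB : B → Q) : Prop :=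
  ∃ f : A → B, Monotone f ∧ ∀ x, cA x ≤ cB (f x)

theorem coe_covBy_coe_upperCone {P : Type*} [PartialOrder P] {v : P} {a b : {w : P // v ≤ w}} :
    a.1 ⋖ b.1 ↔ a ⋖ b :=
  ⟨fun h => ⟨h.1, fun d had hdb => h.2 (c := d.1) had hdb⟩,
    fun h => ⟨h.1, fun d had hdb => h.2 (c := ⟨d, a.2.trans had.le⟩) had hdb⟩⟩

theorem isMin_upperCone_iff {P : Type*} [PartialOrder P] {v : P} {a : {w : P // v ≤ w}} :
    IsMin a ↔ a = ⟨v, le_rfl⟩ := by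
  constructor
  · intro h
    exact Subtype.ext (le_antisymm (h (b := ⟨v, le_rfl⟩) a.2) a.2)
  · rintro rfl b _
    exact b.2

/-- The elements of `u(P↾v)` are the covering chains of `P` starting in `v`. -/
theorem isUChain_upperCone_iff {P : Type*} [PartialOrder P] {v : P} {l : List {w : P // v ≤ w}} :
    IsUChain l ↔
      ∃ t, l = ⟨v, le_rfl⟩ :: t ∧ (v :: t.map Subtype.val).IsChain (· ⋖ ·) := by
  have key (t : List {w : P // v ≤ w}) : (v :: t.map Subtype.val).IsChain (· ⋖ ·) ↔
      ((⟨v, le_rfl⟩ : {w : P // v ≤ w}) :: t).IsChain (· ⋖ ·) := by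
    rw [← List.map_cons (f := Subtype.val) (a := (⟨v, le_rfl⟩ : {w : P // v ≤ w})),
      List.isChain_map]
    simp only [coe_covBy_coe_upperCone]
  simp only [key]
  constructor
  · rintro ⟨hne, hmin, hch⟩
    obtain ⟨a, t, rfl⟩ := List.exists_cons_of_ne_nil hne
    obtain rfl := isMin_upperCone_iff.1 (hmin a rfl)
    exact ⟨t, rfl, hch⟩
  · rintro ⟨t, rfl, hch⟩
    refine ⟨List.cons_ne_nil _ _, fun x hx => ?_, hch⟩
    exact isMin_upperCone_iff.2 (Option.some.inj hx).symm

/-- The elements of `u(P)` extending `u` are obtained by continuing `u` along a covering chain. -/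
theorem isUChain_append_iff {P : Type*} [PartialOrder P] (u : Unf P) (s : List P) :
    IsUChain (u.1 ++ s) ↔ (lastOf u :: s).IsChain (· ⋖ ·) := by
  have hu : u.1.dropLast ++ [lastOf u] = u.1 := List.dropLast_append_getLast u.2.1
  have hch : (u.1 ++ s).IsChain (· ⋖ ·) ↔ (lastOf u :: s).IsChain (· ⋖ ·) := by
    have h : u.1 ++ s = u.1.dropLast ++ lastOf u :: s := by
      conv_lhs => rw [← hu]
      simp
    rw [h, List.isChain_split, hu]
    exact and_iff_right u.2.2.2
  refine ⟨fun h => hch.1 h.2.2, fun h => ⟨by simp [u.2.1], ?_, hch.2 h⟩⟩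
  rw [List.head?_append_of_ne_nil _ u.2.1]
  exact u.2.2.1

/-- Continue `u` along a chain starting in the last element of `u`. -/
def Unf.extend {P : Type*} [PartialOrder P] (u : Unf P) (l : Unf {w : P // lastOf u ≤ w}) :
    {w : Unf P // u ≤ w} :=
  ⟨⟨u.1 ++ l.1.tail.map Subtype.val, by
    obtain ⟨t, ht, hch⟩ := isUChain_upperCone_iff.1 l.2
    rw [ht]
    exact (isUChain_append_iff u _).2 hch⟩, List.prefix_append _ _⟩

theorem Unf.extend_le_extend_iff {P : Type*} [PartialOrder P] (u : Unf P)
    {l m : Unf {w : P // lastOf u ≤ w}} : u.extend l ≤ u.extend m ↔ l ≤ m := by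
  obtain ⟨s, hs, -⟩ := isUChain_upperCone_iff.1 l.2
  obtain ⟨t, ht, -⟩ := isUChain_upperCone_iff.1 m.2
  change u.1 ++ l.1.tail.map Subtype.val <+: u.1 ++ m.1.tail.map Subtype.val ↔ l.1 <+: m.1
  rw [hs, ht, List.prefix_append_right_inj, List.prefix_cons_inj, List.tail_cons, List.tail_cons,
    List.prefix_map_iff_of_injective Subtype.val_injective]

theorem Unf.extend_surjective {P : Type*} [PartialOrder P] (u : Unf P) :
    Function.Surjective u.extend := by
  rintro ⟨⟨w, hw⟩, hle⟩
  obtain ⟨s, hs⟩ := id hle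
  obtain rfl : u.1 ++ s = w := hs
  have hch := (isUChain_append_iff u s).1 hw
  have hge : ∀ x ∈ s, lastOf u ≤ x :=
    fun _ => List.rel_of_pairwise_cons (hch.imp fun _ _ h => h.le).pairwise
  lift s to List {w : P // lastOf u ≤ w} using hge
  exact ⟨⟨_, isUChain_upperCone_iff.2 ⟨s, rfl, hch⟩⟩, rfl⟩

theorem Unf.lastOf_extend {P : Type*} [PartialOrder P] (u : Unf P)
    (l : Unf {w : P // lastOf u ≤ w}) : lastOf (u.extend l).1 = (lastOf l).1 := by
  obtain ⟨l, hl⟩ := l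
  obtain ⟨t, rfl, -⟩ := isUChain_upperCone_iff.1 hl
  rcases eq_or_ne t [] with rfl | ht
  · simp [lastOf, Unf.extend]
  · have hmap : t.map Subtype.val ≠ [] := mt List.map_eq_nil_iff.1 ht
    calc
      lastOf (u.extend ⟨_, hl⟩).1 = (t.map Subtype.val).getLast hmap :=
        List.getLast_append_of_ne_nil _ hmap
      _ = (t.getLast ht).1 := List.getLast_map hmap
      _ = _ := congrArg Subtype.val (List.getLast_cons ht).symm

/-- If `u` is an element of the unfolding `u(P)` whose last element
is `v`, then the `Q`-posets `u(P↾v)` and `u(P)↾u` are isomorphic (there is an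
order isomorphism preserving the labels). Here `P↾v` is the upper cone of `v`. -/
theorem stmt_1 {Q : Type*} [Preorder Q] {P : Type*} [PartialOrder P] [Fintype P] [Nonempty P]
    (c : P → Q) (v : P) (u : Unf P) (hu : lastOf u = v) :
    ∃ e : Unf {w : P // v ≤ w} ≃o {w : Unf P // u ≤ w},
      ∀ l : Unf {w : P // v ≤ w},
        unfLabel c (e l).1 = unfLabel (fun w : {w : P // v ≤ w} => c w.1) l := by
  subst hu
  exact ⟨OrderIso.ofSurjective
    (OrderEmbedding.ofMapLEIff u.extend fun _ _ => u.extend_le_extend_iff) u.extend_surjective, fun l => congrArg c (u.lastOf_extend l)⟩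
end

section
/- Let M = (Q, f, in) be a deterministic automaton over alphabet X and let S ⊆ Q be a nonempty set of states reachable from the initial state (i.e., some state of S is reachable from in). Then S is a cycle of M (S ∈ C_M) if and only if there is a finite family D_1, ..., D_m of elementary cycles of the transition graph of M with D_1 ∪ ... ∪ D_m = S such that the intersection graph on {D_1, ..., D_m} (with D_i adjacent to D_j iff D_i ∩ D_j ≠ ∅) is connected. -/
/-- Extension of the transition function of an automaton to finite words:
`fext f q w` is the state reached from `q` after reading the word `w`. -/
def fext {S X : Type*} (f : S → X → S) (q : S) (w : List X) : S := w.foldl f q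

/-- `Reach f p q` : the state `q` is reachable from the state `p`. -/
def Reach {S X : Type*} (f : S → X → S) (p q : S) : Prop := ∃ w : List X, fext f p w = q

/-- The run of an automaton with transition function `f` and initial state `init`
on the ω-word `ξ`. -/
def run {S X : Type*} (f : S → X → S) (init : S) (ξ : ℕ → X) : ℕ → S
  | 0 => init
  | n + 1 => f (run f init ξ n) (ξ n)

/-- `infOcc f init ξ = f_M(ξ)` : the set of states occurring infinitely often
in the run of the automaton on the ω-word `ξ`. -/
def infOcc {S X : Type*} (f : S → X → S) (init : S) (ξ : ℕ → X) : Set S :=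
  {q | {n : ℕ | run f init ξ n = q}.Infinite}

/-- `cycles f init = C_M` : the set of cycles (loops) of the automaton. -/
def cycles {S X : Type*} (f : S → X → S) (init : S) : Set (Set S) :=
  {c | ∃ ξ : ℕ → X, infOcc f init ξ = c}

/-- An elementary cycle of the transition graph of the automaton: a set
`{v₁, …, v_t}` of distinct states admitting letters `x₁, …, x_t` with
`f v_i x_i = v_{i+1}` for `i < t` and `f v_t x_t = v₁`. -/
def ElemCycle {S X : Type*} (f : S → X → S) (D : Set S) : Prop :=
  ∃ l : List S, ∃ h : l ≠ [], l.Nodup ∧ D = {q | q ∈ l} ∧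
    l.Chain' (fun p q => ∃ x : X, f p x = q) ∧ ∃ x : X, f (l.getLast h) x = l.head h

/-- One transition of the automaton that stays inside the set of states `s`. -/
def StepIn {S X : Type*} (f : S → X → S) (s : Set S) (p q : S) : Prop :=
  p ∈ s ∧ q ∈ s ∧ ∃ x : X, f p x = q

/-- Any two states of `s` are joined by a nonempty path inside `s`. -/
def StronglyConnectedIn {S X : Type*} (f : S → X → S) (s : Set S) : Prop :=
  ∀ p ∈ s, ∀ q ∈ s, Relation.TransGen (StepIn f s) p q

section

variable {S X : Type*} {f : S → X → S} {s t : Set S} {p q : S}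

theorem StepIn.mono (hst : s ⊆ t) (h : StepIn f s p q) : StepIn f t p q :=
  ⟨hst h.1, hst h.2.1, h.2.2⟩

theorem fext_append (f : S → X → S) (q : S) (u v : List X) :
    fext f q (u ++ v) = fext f (fext f q u) v := by
  simp [fext]

theorem run_add (f : S → X → S) (q : S) (ξ : ℕ → X) (n k : ℕ) :
    run f q ξ (n + k) = run f (run f q ξ n) (fun i => ξ (n + i)) k := by
  induction k with
  | zero => rfl
  | succ k ih => rw [← Nat.add_assoc, run, ih, run]

/-- Prepending a letter to an ω-word does not change the set of states visited infinitely often. -/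
theorem infOcc_cons (f : S → X → S) (q : S) (x : X) (ξ : ℕ → X) :
    infOcc f q (fun n => Nat.casesOn n x ξ) = infOcc f (f q x) ξ := by
  have key (n : ℕ) : run f q (fun n => Nat.casesOn n x ξ) (n + 1) = run f (f q x) ξ n := by
    rw [Nat.add_comm, run_add]
    simp only [run, Nat.add_comm 1]
  ext r
  simp only [infOcc, Set.mem_ofPred_eq, ← Nat.frequently_atTop_iff_infinite, ← key]
  conv_lhs => rw [← Filter.map_add_atTop_eq_nat 1]
  exact Filter.frequently_map

theorem mem_cycles_of_fext (w : List X) (h : s ∈ cycles f (fext f p w)) : s ∈ cycles f p := by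
  induction w generalizing p with
  | nil => exact h
  | cons x w ih =>
    obtain ⟨ξ, hξ⟩ := ih (p := f p x) h
    exact ⟨_, (infOcc_cons f p x ξ).trans hξ⟩

theorem stronglyConnectedIn_infOcc [Finite S] (f : S → X → S) (init : S) (ξ : ℕ → X) :
    StronglyConnectedIn f (infOcc f init ξ) := by
  have hev : ∀ᶠ n in Filter.atTop, run f init ξ n ∈ infOcc f init ξ := by
    have hall : ∀ᶠ n in Filter.atTop, ∀ q, q ∉ infOcc f init ξ → run f init ξ n ≠ q := by
      refine Filter.eventually_all.2 fun q => ?_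
      by_cases hq : q ∈ infOcc f init ξ
      · exact Filter.Eventually.of_forall fun n hn => absurd hq hn
      · have := hq
        rw [infOcc, Set.mem_ofPred_eq, ← Nat.frequently_atTop_iff_infinite,
          Filter.not_frequently] at this
        exact this.mono fun n hn _ => hn
    exact hall.mono fun n hn => by_contra fun h => hn _ h rfl
  obtain ⟨N, hN⟩ := Filter.eventually_atTop.1 hev
  have hstep (n : ℕ) (hn : N ≤ n) (k : ℕ) : Relation.TransGen (StepIn f (infOcc f init ξ))
      (run f init ξ n) (run f init ξ (n + k + 1)) := by
    have hE (m : ℕ) (hm : N ≤ m) : StepIn f (infOcc f init ξ) (run f init ξ m)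
        (run f init ξ (m + 1)) := ⟨hN _ hm, hN _ (by omega), ξ m, rfl⟩
    induction k with
    | zero => exact .single (hE n hn)
    | succ k ih => exact ih.tail (hE _ (by omega))
  intro p hp q hq
  obtain ⟨n, hn, hnN⟩ := Set.Infinite.exists_gt hp N
  obtain ⟨m, hm, hmn⟩ := Set.Infinite.exists_gt hq n
  obtain ⟨k, rfl⟩ := Nat.exists_eq_add_of_lt hmn
  have := hstep n hnN.le k
  rwa [hn, hm] at this

/-- The set of states visited when reading `w` from `q`. -/
def visited (f : S → X → S) (q : S) (w : List X) : Set S :=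
  {r | ∃ u v, w = u ++ v ∧ fext f q u = r}

theorem visited_append (f : S → X → S) (q : S) (u v : List X) :
    visited f q (u ++ v) = visited f q u ∪ visited f (fext f q u) v := by
  ext r
  constructor
  · rintro ⟨a, b, h, rfl⟩
    rcases List.append_eq_append_iff.1 h with ⟨c, rfl, rfl⟩ | ⟨c, rfl, rfl⟩
    · exact Or.inr ⟨c, b, rfl, (fext_append ..).symm⟩
    · exact Or.inl ⟨a, c, rfl, rfl⟩
  · rintro (⟨a, b, rfl, rfl⟩ | ⟨a, b, rfl, rfl⟩)
    · exact ⟨a, b ++ v, by simp, rfl⟩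
    · exact ⟨u ++ a, b, by simp, fext_append ..⟩

theorem fext_mem_visited (f : S → X → S) (q : S) (w : List X) : fext f q w ∈ visited f q w :=
  ⟨w, [], by simp, rfl⟩

theorem exists_word_of_transGen (h : Relation.TransGen (StepIn f s) p q) :
    ∃ w : List X, w ≠ [] ∧ fext f p w = q ∧ visited f p w ⊆ s := by
  have single {p q : S} (h : StepIn f s p q) : ∃ x : X, f p x = q ∧ visited f p [x] ⊆ s := by
    obtain ⟨hp, hq, x, rfl⟩ := h
    refine ⟨x, rfl, ?_⟩
    rintro _ ⟨u, v, h, rfl⟩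
    rcases List.append_eq_singleton_iff.1 h.symm with ⟨rfl, -⟩ | ⟨rfl, -⟩
    · exact hp
    · exact hq
  induction h with
  | single h =>
    obtain ⟨x, hx, hv⟩ := single h
    exact ⟨[x], by simp, hx, hv⟩
  | tail _ h ih =>
    obtain ⟨w, hw, rfl, hv⟩ := ih
    obtain ⟨x, hx, hv'⟩ := single h
    refine ⟨w ++ [x], by simp, by rw [fext_append]; exact hx, ?_⟩
    rw [visited_append]
    exact Set.union_subset hv hv'

theorem StronglyConnectedIn.exists_closed_word [Finite S] (hs : StronglyConnectedIn f s)
    (hq : q ∈ s) : ∃ w : List X, w ≠ [] ∧ fext f q w = q ∧ visited f q w = s := by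
  have main (T : Set S) (hT : T.Finite) (hTs : T ⊆ s) :
      ∃ w : List X, w ≠ [] ∧ fext f q w = q ∧ visited f q w ⊆ s ∧ T ⊆ visited f q w := by
    induction T, hT using Set.Finite.induction_on with
    | empty =>
      obtain ⟨w, hw, hqw, hv⟩ := exists_word_of_transGen (hs q hq q hq)
      exact ⟨w, hw, hqw, hv, Set.empty_subset _⟩
    | @insert p T _ _ ih =>
      obtain ⟨hp, hT⟩ := Set.insert_subset_iff.1 hTs
      obtain ⟨w, hw, hqw, hv, hTw⟩ := ih hT
      obtain ⟨a, -, rfl, hva⟩ := exists_word_of_transGen (hs q hq p hp)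
      obtain ⟨b, -, hb, hvb⟩ := exists_word_of_transGen (hs _ hp q hq)
      refine ⟨w ++ (a ++ b), by simp [hw], by rw [fext_append, hqw, fext_append, hb], ?_, ?_⟩
      · rw [visited_append, visited_append, hqw]
        exact Set.union_subset hv (Set.union_subset hva hvb)
      · rw [visited_append, visited_append, hqw]
        exact Set.insert_subset (Or.inr (Or.inl (fext_mem_visited ..)))
          (hTw.trans Set.subset_union_left)
  obtain ⟨w, hw, hqw, hv, hT⟩ := main s s.toFinite subset_rfl
  exact ⟨w, hw, hqw, hv.antisymm hT⟩

theorem visited_mem_cycles (w : List X) (hw : w ≠ []) (hq : fext f q w = q) :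
    visited f q w ∈ cycles f q := by
  have hL : 0 < w.length := List.length_pos_of_ne_nil hw
  set ξ : ℕ → X := fun n => w[n % w.length]'(Nat.mod_lt _ hL) with hξ
  have hrun (i : ℕ) (hi : i ≤ w.length) : run f q ξ i = fext f q (w.take i) := by
    induction i with
    | zero => rfl
    | succ i ih =>
      rw [run, ih (by omega), List.take_add_one, fext_append, List.getElem?_eq_getElem hi]
      simp [hξ, fext, Nat.mod_eq_of_lt hi]
  have hper (i k : ℕ) : run f q ξ (w.length * k + i) = run f q ξ i := by
    induction k with
    | zero => simp
    | succ k ih =>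
      rw [show w.length * (k + 1) + i = w.length + (w.length * k + i) by ring, run_add,
        hrun _ le_rfl, List.take_length, hq, ← ih]
      congr 1
      funext n
      simp [hξ]
  refine ⟨ξ, Set.Subset.antisymm ?_ ?_⟩
  · intro r hr
    obtain ⟨n, rfl⟩ := Set.Infinite.nonempty hr
    rw [← Nat.div_add_mod n w.length, hper, hrun _ (Nat.mod_lt _ hL).le]
    exact ⟨_, _, (List.take_append_drop _ _).symm, rfl⟩
  · rintro _ ⟨u, v, huv, rfl⟩
    refine Set.infinite_of_injective_forall_mem (f := fun k => w.length * k + u.length)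
      (fun a b hab => ?_) fun k => ?_
    · exact Nat.eq_of_mul_eq_mul_left hL (Nat.add_right_cancel hab)
    · rw [Set.mem_ofPred_eq, hper, hrun _ (by simp [huv]), huv, List.take_left]

theorem mem_cycles_iff_stronglyConnectedIn [Finite S] {init : S}
    (hreach : ∃ q ∈ s, Reach f init q) : s ∈ cycles f init ↔ StronglyConnectedIn f s := by
  constructor
  · rintro ⟨ξ, rfl⟩
    exact stronglyConnectedIn_infOcc f init ξ
  · intro hs
    obtain ⟨q, hq, u, rfl⟩ := hreach
    obtain ⟨w, hw, hqw, hv⟩ := hs.exists_closed_word hq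
    exact mem_cycles_of_fext u (hv ▸ visited_mem_cycles w hw hqw)

theorem List.IsChain.reflTransGen_head_getLast {R : S → S → Prop} {a : S} {l : List S}
    (h : (a :: l).IsChain R) (hp : p ∈ a :: l) :
    Relation.ReflTransGen R a p ∧
      Relation.ReflTransGen R p ((a :: l).getLast (List.cons_ne_nil a l)) := by
  induction l generalizing a p with
  | nil =>
    obtain rfl := List.mem_singleton.1 hp
    exact ⟨.refl, .refl⟩
  | cons b l ih =>
    rw [List.isChain_cons_cons] at h
    rw [List.getLast_cons_cons]
    rcases List.mem_cons.1 hp with rfl | hp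
    · exact ⟨.refl, (ih h.2 List.mem_cons_self).2.head h.1⟩
    · exact ⟨(ih h.2 hp).1.head h.1, (ih h.2 hp).2⟩

theorem ElemCycle.stronglyConnectedIn (h : ElemCycle f s) : StronglyConnectedIn f s := by
  obtain ⟨l, hl, -, rfl, hchain, x, hx⟩ := h
  have hE : l.IsChain (StepIn f {q | q ∈ l}) := by
    refine List.isChain_iff_getElem.2 fun i hi => ?_
    exact ⟨List.getElem_mem _, List.getElem_mem _, List.isChain_iff_getElem.1 hchain i hi⟩
  obtain ⟨a, l, rfl⟩ := List.exists_cons_of_ne_nil hl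
  intro p hp q hq
  have hback : StepIn f {q | q ∈ a :: l} ((a :: l).getLast hl) a :=
    ⟨List.getLast_mem hl, List.mem_cons_self, x, hx⟩
  exact (Relation.TransGen.tail' (hE.reflTransGen_head_getLast hp).2 hback).trans_left
    (hE.reflTransGen_head_getLast hq).1

theorem stronglyConnectedIn_iUnion {ι : Type*} {D : ι → Set S} (hD : ∀ i, ElemCycle f (D i))
    (hconn : ∀ i j, Relation.ReflTransGen (fun a b => (D a ∩ D b).Nonempty) i j) :
    StronglyConnectedIn f (⋃ i, D i) := by
  have hin (i : ι) {p q : S} (hp : p ∈ D i) (hq : q ∈ D i) :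
      Relation.TransGen (StepIn f (⋃ i, D i)) p q :=
    Relation.TransGen.mono (fun _ _ h => StepIn.mono (Set.subset_iUnion D i) h) _ _
      ((hD i).stronglyConnectedIn p hp q hq)
  intro p hp q hq
  obtain ⟨i, hp⟩ := Set.mem_iUnion.1 hp
  obtain ⟨j, hq⟩ := Set.mem_iUnion.1 hq
  induction hconn i j generalizing q with
  | refl => exact hin i hp hq
  | tail _ h ih =>
    obtain ⟨r, hr, hr'⟩ := h
    exact (ih r (Set.mem_iUnion_of_mem _ hr) hr).trans (hin _ hr' hq)

/-- A path can be shortened to one without repetitions. -/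
theorem exists_nodup_isChain_of_reflTransGen {R : S → S → Prop}
    (h : Relation.ReflTransGen R p q) :
    ∃ l : List S, (p :: l).Nodup ∧ (p :: l).IsChain R ∧
      (p :: l).getLast (List.cons_ne_nil p l) = q := by
  induction h using Relation.ReflTransGen.head_induction_on with
  | refl => exact ⟨[], by simp⟩
  | @head p r hpr _ ih =>
    obtain ⟨l, hnd, hch, hlast⟩ := ih
    by_cases hp : p ∈ r :: l
    · obtain ⟨a, b, hab⟩ := List.append_of_mem hp
      refine ⟨b, ?_, ?_, ?_⟩
      · rw [hab] at hnd
        exact (List.nodup_append.1 hnd).2.1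
      · rw [hab] at hch
        exact hch.right_of_append
      · simp only [hab] at hlast
        rwa [List.getLast_append_of_ne_nil] at hlast
    · refine ⟨r :: l, List.nodup_cons.2 ⟨hp, hnd⟩, List.isChain_cons_cons.2 ⟨hpr, hch⟩, ?_⟩
      rwa [List.getLast_cons_cons]

theorem StronglyConnectedIn.exists_elemCycle (hs : StronglyConnectedIn f s)
    (h : StepIn f s p q) : ∃ D, ElemCycle f D ∧ D ⊆ s ∧ p ∈ D ∧ q ∈ D := by
  obtain ⟨l, hnd, hch, hlast⟩ :=
    exists_nodup_isChain_of_reflTransGen (hs q h.2.1 p h.1).to_reflTransGen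
  refine ⟨{r | r ∈ q :: l}, ⟨q :: l, List.cons_ne_nil q l, hnd, rfl,
    hch.imp fun _ _ h => h.2.2, ?_⟩, fun r hr => ?_, ?_, List.mem_cons_self⟩
  · rw [hlast]
    exact h.2.2
  · rcases (hch.reflTransGen_head_getLast hr).1.cases_tail with rfl | ⟨_, _, hr⟩
    · exact h.2.1
    · exact hr.2.1
  · exact hlast ▸ List.getLast_mem (List.cons_ne_nil q l)

theorem StronglyConnectedIn.exists_elemCycle_family [Finite S] (hs : StronglyConnectedIn f s) :
    ∃ (m : ℕ) (D : Fin m → Set S), (∀ i, ElemCycle f (D i)) ∧ (⋃ i, D i) = s ∧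
      ∀ i j : Fin m, Relation.ReflTransGen (fun a b : Fin m => (D a ∩ D b).Nonempty) i j := by
  obtain ⟨m, ⟨e⟩⟩ := Finite.exists_equiv_fin {D : Set S // ElemCycle f D ∧ D ⊆ s}
  have hex {p q : S} (h : StepIn f s p q) : ∃ i, p ∈ (e.symm i).1 ∧ q ∈ (e.symm i).1 := by
    obtain ⟨D, hD, hDs, hp, hq⟩ := hs.exists_elemCycle h
    exact ⟨e ⟨D, hD, hDs⟩, by simpa using ⟨hp, hq⟩⟩
  refine ⟨m, fun i => (e.symm i).1, fun i => (e.symm i).2.1, ?_, fun i j => ?_⟩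
  · refine (Set.iUnion_subset fun i => (e.symm i).2.2).antisymm fun p hp => ?_
    obtain ⟨r, hr, -⟩ := Relation.TransGen.head'_iff.1 (hs p hp p hp)
    obtain ⟨i, hi, -⟩ := hex hr
    exact Set.mem_iUnion_of_mem i hi
  · have hne (i : Fin m) : ∃ p, p ∈ (e.symm i).1 := by
      obtain ⟨l, hl, -, hD, -⟩ := (e.symm i).2.1
      exact ⟨l.head hl, hD ▸ List.head_mem hl⟩
    obtain ⟨p, hp⟩ := hne i
    obtain ⟨q, hq⟩ := hne j
    have hpq := (hs p ((e.symm i).2.2 hp) q ((e.symm j).2.2 hq)).to_reflTransGen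
    induction hpq generalizing j with
    | refl => exact .single ⟨p, hp, hq⟩
    | tail _ h ih =>
      obtain ⟨k, hk, hk'⟩ := hex h
      exact (ih k hk).tail ⟨_, hk', hq⟩

end

/-- A nonempty set of states `s` reachable from the initial state is
a cycle of the automaton iff it is the union of a finite family of elementary
cycles of the transition graph whose intersection graph is connected. -/
theorem stmt_11 {S X : Type*} [Fintype S] [Nonempty S] [Fintype X]
    (f : S → X → S) (init : S) (s : Set S) (hne : s.Nonempty)
    (hreach : ∃ q ∈ s, Reach f init q) :
    s ∈ cycles f init ↔
      ∃ (m : ℕ) (D : Fin m → Set S),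
        (∀ i, ElemCycle f (D i)) ∧ (⋃ i, D i) = s ∧
        ∀ i j : Fin m,
          Relation.ReflTransGen (fun a b : Fin m => (D a ∩ D b).Nonempty) i j := by
  rw [mem_cycles_iff_stronglyConnectedIn hreach]
  constructor
  · exact StronglyConnectedIn.exists_elemCycle_family
  · rintro ⟨m, D, hD, rfl, hconn⟩
    exact stronglyConnectedIn_iUnion hD hconn
end

section
/- Let Q be a preorder and F a Q-forest. Then u(F) ≤_h F and F ≤_h u(F); consequently, on Q-forests the relations ≤_h and ⪯ coincide: for Q-forests F, G one has F ⪯ G if and only if F ≤_h G. -/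
namespace Unf

variable {P : Type*} [PartialOrder P]

theorem lastOf_monotone : Monotone (lastOf : Unf P → P) := by
  rintro ⟨l, hl⟩ ⟨m, hm⟩ ⟨t, ht⟩
  dsimp only at ht
  subst ht
  rcases eq_or_ne t [] with rfl | hne
  · simp [lastOf]
  · have hpw : (l ++ t).Pairwise (· < ·) :=
      List.isChain_iff_pairwise.1 (hm.2.2.imp fun _ _ h => h.lt)
    have hlast : lastOf ⟨l ++ t, hm⟩ = t.getLast hne :=
      List.getLast_append_of_ne_nil _ hne
    rw [hlast]
    exact ((List.pairwise_append.1 hpw).2.2 _ (List.getLast_mem hl.1) _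
      (List.getLast_mem hne)).le

/-- A covering chain ending in `x` extends by any cover of `x`. -/
theorem exists_ge_of_covBy (a : Unf P) {y : P} (h : lastOf a ⋖ y) :
    ∃ b : Unf P, a ≤ b ∧ lastOf b = y := by
  refine ⟨⟨a.1 ++ [y], by simp, ?_, ?_⟩, List.prefix_append _ _, by simp [lastOf]⟩
  · rw [List.head?_append_of_ne_nil _ a.2.1]
    exact a.2.2.1
  · refine List.isChain_append.2 ⟨a.2.2.2, List.isChain_singleton _, ?_⟩
    intro u hu v hv
    rw [List.getLast?_eq_some_getLast a.2.1] at hu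
    simp only [Option.mem_def, Option.some.injEq, List.head?_cons] at hu hv
    subst hu hv
    exact h

theorem exists_ge_of_le [Finite P] (a : Unf P) {y : P} (h : lastOf a ≤ y) :
    ∃ b : Unf P, a ≤ b ∧ lastOf b = y := by
  induction y using WellFoundedLT.induction with
  | ind y ih =>
    rcases h.eq_or_lt with h | h
    · exact ⟨a, le_rfl, h⟩
    · obtain ⟨z, haz, hzy⟩ := exists_le_covBy_of_lt h
      obtain ⟨b, hab, rfl⟩ := ih z hzy.lt haz
      obtain ⟨d, hbd, hd⟩ := b.exists_ge_of_covBy hzy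
      exact ⟨d, hab.trans hbd, hd⟩

theorem lastOf_surjective [Finite P] : Function.Surjective (lastOf : Unf P → P) := by
  intro x
  obtain ⟨m, hmx, hm⟩ := Set.Finite.exists_le_minimal (Set.toFinite Set.univ) (Set.mem_univ x)
  have hmin : IsMin m := minimal_true.1 (by simpa using hm)
  let a : Unf P := ⟨[m], by simp, by simpa using hmin, List.isChain_singleton _⟩
  obtain ⟨b, -, hb⟩ := a.exists_ge_of_le (y := x) hmx
  exact ⟨b, hb⟩

theorem _root_.IsUChain.of_concat {l : List P} {x : P} (h : IsUChain (l ++ [x])) (hl : l ≠ []) :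
    IsUChain l ∧ l.getLast hl ⋖ x := by
  obtain ⟨-, hmin, hch⟩ := h
  rw [List.head?_append_of_ne_nil _ hl] at hmin
  have h := List.isChain_append.1 hch
  exact ⟨⟨hl, hmin, h.1⟩, h.2.2 _ (List.getLast_mem_getLast? hl) _ rfl⟩

/-- In a forest, a covering chain is determined by its last element. -/
theorem lastOf_injective (hP : ∀ x : P, IsChain (· ≤ ·) {y : P | y ≤ x}) :
    Function.Injective (lastOf : Unf P → P) := by
  suffices H : ∀ (l m : List P) (hl : IsUChain l) (hm : IsUChain m),
      l.getLast hl.1 = m.getLast hm.1 → l = m from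
    fun a b h => Subtype.ext (H a.1 b.1 a.2 b.2 h)
  intro l
  induction l using List.reverseRecOn with
  | nil => exact fun _ hl => absurd rfl hl.1
  | append_singleton l x ih =>
    intro m hl hm h
    obtain ⟨m, z, rfl⟩ := (List.eq_nil_or_concat' m).resolve_left hm.1
    simp only [List.getLast_append_singleton] at h
    subst h
    rcases eq_or_ne l [] with rfl | hl' <;> rcases eq_or_ne m [] with rfl | hm'
    · rfl
    · exact absurd (hm.of_concat hm').2.lt (IsMin.not_lt (hl.2.1 _ rfl))
    · exact absurd (hl.of_concat hl').2.lt (IsMin.not_lt (hm.2.1 _ rfl))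
    · obtain ⟨hlc, hlx⟩ := hl.of_concat hl'
      obtain ⟨hmc, hmx⟩ := hm.of_concat hm'
      rw [ih m hlc hmc]
      rcases (hP x).total hlx.le hmx.le with hle | hle
      · exact hle.eq_of_not_lt fun hlt => hlx.2 hlt hmx.lt
      · exact (hle.eq_of_not_lt fun hlt => hmx.2 hlt hlx.lt).symm

end Unf

section Hle

variable {P Q : Type*} [PartialOrder P] [Preorder Q]

theorem Hle.trans {A B C : Type*} [Preorder A] [Preorder B] [Preorder C]
    {cA : A → Q} {cB : B → Q} {cC : C → Q} : Hle cA cB → Hle cB cC → Hle cA cC := by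
  rintro ⟨f, hf, hfc⟩ ⟨g, hg, hgc⟩
  exact ⟨g ∘ f, hg.comp hf, fun x => (hfc x).trans (hgc _)⟩

theorem hle_unfLabel_left (c : P → Q) : Hle (unfLabel c) c :=
  ⟨lastOf, Unf.lastOf_monotone, fun _ => le_rfl⟩

theorem hle_unfLabel_right [Finite P] (c : P → Q)
    (hP : ∀ x : P, IsChain (· ≤ ·) {y : P | y ≤ x}) : Hle c (unfLabel c) := by
  choose f hf using Unf.lastOf_surjective (P := P)
  refine ⟨f, fun x y hxy => ?_, fun x => (congrArg c (hf x)).ge⟩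
  obtain ⟨b, hb, hby⟩ := (f x).exists_ge_of_le (y := y) ((hf x).trans_le hxy)
  rwa [Unf.lastOf_injective hP (hby.trans (hf y).symm)] at hb

end Hle

/-- For `Q`-forests `F` (posets in which every lower cone is a chain),
`u(F) ≤_h F` and `F ≤_h u(F)`; consequently on `Q`-forests the relations `≤_h`
and `⪯` coincide: `F ⪯ G` (i.e. `u(F) ≤_h u(G)`) iff `F ≤_h G`. -/
theorem stmt_12 {Q : Type*} [Preorder Q] {F G : Type*}
    [PartialOrder F] [Fintype F] [Nonempty F]
    [PartialOrder G] [Fintype G] [Nonempty G]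
    (cF : F → Q) (cG : G → Q)
    (hF : ∀ x : F, IsChain (· ≤ ·) {y : F | y ≤ x})
    (hG : ∀ x : G, IsChain (· ≤ ·) {y : G | y ≤ x}) :
    (Hle (unfLabel cF) cF ∧ Hle cF (unfLabel cF)) ∧
      (Hle (unfLabel cF) (unfLabel cG) ↔ Hle cF cG) := by
  have hF' := hle_unfLabel_right cF hF
  have hG' := hle_unfLabel_right cG hG
  exact ⟨⟨hle_unfLabel_left cF, hF'⟩,
    fun h => (hF'.trans h).trans (hle_unfLabel_left cG),
    fun h => ((hle_unfLabel_left cF).trans h).trans hG'⟩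
end

section
/- Let M be a deterministic automaton with n states over an alphabet of size d ≥ 1, and suppose n ≥ d + 1. Then the number of cycles of M of cardinality at least 2 is at most (2^{d+1} − 1)^{n/(d+1)}. -/
/-- **AM-GM inequality** in product form. -/
theorem prod_le_sum_div_card_pow {ι : Type*} (s : Finset ι) (hs : s.Nonempty) (z : ι → ℝ)
    (hz : ∀ i ∈ s, 0 ≤ z i) : ∏ i ∈ s, z i ≤ ((∑ i ∈ s, z i) / s.card) ^ s.card := by
  have hk : 0 < s.card := hs.card_pos
  have h := Real.geom_mean_le_arith_mean s (fun _ => 1) z (fun _ _ => zero_le_one)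
    (by simpa using hs) hz
  simp only [Real.rpow_one, one_mul, Finset.sum_const, nsmul_eq_mul, mul_one] at h
  have hP : 0 ≤ ∏ i ∈ s, z i := Finset.prod_nonneg hz
  calc ∏ i ∈ s, z i = ((∏ i ∈ s, z i) ^ ((s.card : ℝ)⁻¹)) ^ s.card :=
        (Real.rpow_inv_natCast_pow hP hk.ne').symm
    _ ≤ _ := pow_le_pow_left₀ (Real.rpow_nonneg hP _) h _

/-- Superadditivity of the geometric mean, in product form. -/
theorem add_pow_card_le_mul_prod_add {ι : Type*} (s : Finset ι) (hs : s.Nonempty) (a b : ι → ℝ)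
    (ha : ∀ i ∈ s, 0 ≤ a i) (hb : ∀ i ∈ s, 0 ≤ b i) {A x y : ℝ} (hA : 0 ≤ A) (hx : 0 ≤ x)
    (hy : 0 ≤ y) (hxa : x ^ s.card ≤ A * ∏ i ∈ s, a i) (hyb : y ^ s.card ≤ A * ∏ i ∈ s, b i) :
    (x + y) ^ s.card ≤ A * ∏ i ∈ s, (a i + b i) := by
  have hk : 0 < s.card := hs.card_pos
  have hk' : (0 : ℝ) < s.card := by exact_mod_cast hk
  have hab : ∀ i ∈ s, 0 ≤ a i + b i := fun i hi => add_nonneg (ha i hi) (hb i hi)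
  have hP : 0 ≤ A * ∏ i ∈ s, (a i + b i) := mul_nonneg hA (Finset.prod_nonneg hab)
  have le_a : A * ∏ i ∈ s, a i ≤ A * ∏ i ∈ s, (a i + b i) :=
    mul_le_mul_of_nonneg_left
      (Finset.prod_le_prod ha fun i hi => le_add_of_nonneg_right (hb i hi)) hA
  have le_b : A * ∏ i ∈ s, b i ≤ A * ∏ i ∈ s, (a i + b i) :=
    mul_le_mul_of_nonneg_left
      (Finset.prod_le_prod hb fun i hi => le_add_of_nonneg_left (ha i hi)) hA
  rcases hP.eq_or_lt with h0 | hpos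
  · have hx0 : x = 0 := eq_zero_of_pow_eq_zero
      (le_antisymm ((hxa.trans le_a).trans h0.ge) (pow_nonneg hx s.card))
    have hy0 : y = 0 := eq_zero_of_pow_eq_zero
      (le_antisymm ((hyb.trans le_b).trans h0.ge) (pow_nonneg hy s.card))
    simp [hx0, hy0, hk.ne', ← h0]
  · have hA' : A ≠ 0 := left_ne_zero_of_mul hpos.ne'
    have hne : ∀ i ∈ s, a i + b i ≠ 0 := Finset.prod_ne_zero_iff.mp (right_ne_zero_of_mul hpos.ne')
    obtain ⟨z, hz, hzk⟩ : ∃ z : ℝ, 0 < z ∧ z ^ s.card = A * ∏ i ∈ s, (a i + b i) :=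
      ⟨_, Real.rpow_pos_of_pos hpos _, Real.rpow_inv_natCast_pow hP hk.ne'⟩
    have key : ∀ (c : ι → ℝ) (t : ℝ), (∀ i ∈ s, 0 ≤ c i) → 0 ≤ t →
        t ^ s.card ≤ A * ∏ i ∈ s, c i → t / z ≤ (∑ i ∈ s, c i / (a i + b i)) / s.card := by
      intro c t hc ht htc
      have hq : ∀ i ∈ s, 0 ≤ c i / (a i + b i) := fun i hi => div_nonneg (hc i hi) (hab i hi)
      refine le_of_pow_le_pow_left₀ hk.ne' (div_nonneg (Finset.sum_nonneg hq) hk'.le) ?_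
      refine le_trans ?_ (prod_le_sum_div_card_pow s hs _ hq)
      rw [div_pow, hzk, Finset.prod_div_distrib, ← mul_div_mul_left (∏ i ∈ s, c i) _ hA']
      exact div_le_div_of_nonneg_right htc hP
    have hsum : (x + y) / z ≤ 1 := by
      rw [add_div]
      refine (add_le_add (key a x ha hx hxa) (key b y hb hy hyb)).trans ?_
      rw [← add_div, ← Finset.sum_add_distrib, div_le_one hk']
      refine (Finset.sum_congr rfl fun i hi => ?_).trans_le
        (Finset.sum_const (1 : ℝ)).le |>.trans (by simp)
      rw [← add_div, div_self (hne i hi)]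
    rw [← hzk]
    exact pow_le_pow_left₀ (add_nonneg hx hy) ((div_le_one hz).mp hsum) _

/-- Splitting a family `F` according to membership of a point `v ∈ B` splits its trace on `B`. -/
theorem card_image_inter_add_card_image_inter_le {S : Type*} [DecidableEq S]
    (F : Finset (Finset S)) {B : Finset S} {v : S} (hv : v ∈ B) :
    ((F.filter fun c => v ∉ c).image (· ∩ B)).card +
      (((F.filter fun c => v ∈ c).image fun c => c.erase v).image (· ∩ B)).card ≤
        (F.image (· ∩ B)).card := by
  set F₁ := (F.filter fun c => v ∈ c).image fun c => c.erase v with hF₁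
  have hnot : ∀ t ∈ F₁.image (· ∩ B), v ∉ t := by
    intro t ht
    simp only [hF₁, Finset.mem_image, Finset.mem_filter, exists_exists_and_eq_and] at ht
    obtain ⟨c, -, rfl⟩ := ht
    simp
  have hinj : Set.InjOn (insert v) (F₁.image (· ∩ B) : Set (Finset S)) := by
    intro t ht t' ht' h
    rw [← Finset.erase_insert (hnot t ht), ← Finset.erase_insert (hnot t' ht')]
    exact congrArg (fun u => u.erase v) h
  rw [← Finset.card_image_of_injOn hinj, ← Finset.card_union_of_disjoint]
  · refine Finset.card_le_card (Finset.union_subset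
      (Finset.image_subset_image (Finset.filter_subset _ _)) ?_)
    intro t ht
    simp only [hF₁, Finset.mem_image, Finset.mem_filter, exists_exists_and_eq_and] at ht ⊢
    obtain ⟨c, ⟨hc, hvc⟩, rfl⟩ := ht
    refine ⟨c, hc, ?_⟩
    rw [Finset.erase_inter, Finset.insert_erase (Finset.mem_inter.mpr ⟨hvc, hv⟩)]
  · rw [Finset.disjoint_left]
    intro t ht ht'
    simp only [Finset.mem_image, Finset.mem_filter] at ht
    obtain ⟨c, ⟨-, hvc⟩, rfl⟩ := ht
    obtain ⟨u, -, hu⟩ := Finset.mem_image.mp ht'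
    exact hvc (Finset.mem_inter.mp (hu ▸ Finset.mem_insert_self v u)).1

/-- **Shearer's inequality** for families of finite sets: if every point of the ground set `V` lies
in exactly `k` of the sets `B i`, then `|F| ^ k` is at most the product of the sizes of the traces
of `F` on the sets `B i`. -/
theorem card_pow_le_prod_card_image_inter {S ι : Type*} [DecidableEq S] [Fintype ι]
    (B : ι → Finset S) {k : ℕ} (hk : k ≠ 0) (V : Finset S)
    (hV : ∀ v ∈ V, (Finset.univ.filter fun i => v ∈ B i).card = k)
    (F : Finset (Finset S)) (hF : ∀ c ∈ F, c ⊆ V) :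
    (F.card : ℝ) ^ k ≤ ∏ i, ((F.image (· ∩ B i)).card : ℝ) := by
  induction V using Finset.induction_on generalizing F with
  | empty =>
    rcases F.eq_empty_or_nonempty with rfl | hne
    · simp [hk]
    · have hF1 : F.card ≤ 1 := Finset.card_le_one.mpr fun a ha b hb => by
        rw [Finset.subset_empty.mp (hF a ha), Finset.subset_empty.mp (hF b hb)]
      refine (pow_le_one₀ (Nat.cast_nonneg _) (by exact_mod_cast hF1)).trans ?_
      rw [← Finset.prod_const_one (s := (Finset.univ : Finset ι))]
      refine Finset.prod_le_prod (fun _ _ => zero_le_one) fun i _ => ?_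
      exact_mod_cast (hne.image _).card_pos
  | insert v V hv ih =>
    set F₀ := F.filter fun c => v ∉ c with hF₀
    set F₁ := (F.filter fun c => v ∈ c).image fun c => c.erase v with hF₁
    have hcard : F.card = F₀.card + F₁.card := by
      rw [hF₁, Finset.card_image_of_injOn, add_comm, hF₀]
      · exact (Finset.card_filter_add_card_filter_not _).symm
      · intro c hc c' hc' h
        simp only [Finset.coe_filter, Set.mem_ofPred_eq] at hc hc'
        rw [← Finset.insert_erase hc.2, ← Finset.insert_erase hc'.2]
        exact congrArg (insert v) h
    have hV' : ∀ u ∈ V, (Finset.univ.filter fun i => u ∈ B i).card = k :=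
      fun u hu => hV u (Finset.mem_insert_of_mem hu)
    have ih₀ := ih hV' F₀ fun c hc => by
      rw [hF₀, Finset.mem_filter] at hc
      exact (Finset.subset_insert_iff_of_notMem hc.2).mp (hF c hc.1)
    have ih₁ := ih hV' F₁ fun c hc => by
      simp only [hF₁, Finset.mem_image, Finset.mem_filter] at hc
      obtain ⟨c', ⟨hc', -⟩, rfl⟩ := hc
      exact Finset.subset_insert_iff.mp (hF c' hc')
    have hsub₀ : ∀ i, F₀.image (· ∩ B i) ⊆ F.image (· ∩ B i) := fun i =>
      Finset.image_subset_image (Finset.filter_subset _ _)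
    have hsub₁ : ∀ i, v ∉ B i → F₁.image (· ∩ B i) ⊆ F.image (· ∩ B i) := by
      intro i hi t ht
      simp only [hF₁, Finset.mem_image, Finset.mem_filter, exists_exists_and_eq_and] at ht ⊢
      obtain ⟨c, ⟨hc, -⟩, rfl⟩ := ht
      refine ⟨c, hc, ?_⟩
      rw [Finset.erase_inter, Finset.erase_eq_of_notMem]
      exact fun h => hi (Finset.mem_inter.mp h).2
    have hk' := hV v (Finset.mem_insert_self v V)
    set P := Finset.univ.filter fun i => v ∈ B i with hP
    set R := ∏ i ∈ Finset.univ.filter (fun i => v ∉ B i), ((F.image (· ∩ B i)).card : ℝ)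
    have hR0 : 0 ≤ R := Finset.prod_nonneg fun _ _ => Nat.cast_nonneg _
    have split : ∀ g : ι → ℝ, ∏ i, g i =
        (∏ i ∈ Finset.univ.filter (fun i => v ∉ B i), g i) * ∏ i ∈ P, g i := fun g => by
      rw [mul_comm, hP, Finset.prod_filter_mul_prod_filter_not]
    have bound : ∀ G : Finset (Finset S),
        (∀ i, v ∉ B i → G.image (· ∩ B i) ⊆ F.image (· ∩ B i)) →
        (G.card : ℝ) ^ k ≤ ∏ i, ((G.image (· ∩ B i)).card : ℝ) →
        (G.card : ℝ) ^ P.card ≤ R * ∏ i ∈ P, ((G.image (· ∩ B i)).card : ℝ) := by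
      intro G hG h
      rw [split] at h
      rw [hk']
      have hle : ∏ i ∈ Finset.univ.filter (fun i => v ∉ B i), ((G.image (· ∩ B i)).card : ℝ) ≤ R :=
        Finset.prod_le_prod (fun _ _ => Nat.cast_nonneg _) fun i hi =>
          Nat.cast_le.mpr (Finset.card_le_card (hG i (Finset.mem_filter.mp hi).2))
      exact h.trans (mul_le_mul_of_nonneg_right hle
        (Finset.prod_nonneg fun _ _ => Nat.cast_nonneg _))
    have hPne : P.Nonempty := Finset.card_ne_zero.mp (hk'.trans_ne hk)
    have main := add_pow_card_le_mul_prod_add P hPne _ _ (fun _ _ => Nat.cast_nonneg _)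
      (fun _ _ => Nat.cast_nonneg _) hR0 (Nat.cast_nonneg _) (Nat.cast_nonneg _)
      (bound F₀ (fun i _ => hsub₀ i) ih₀) (bound F₁ hsub₁ ih₁)
    rw [split, hcard, Nat.cast_add, ← hk']
    refine main.trans (mul_le_mul_of_nonneg_left ?_ hR0)
    refine Finset.prod_le_prod (fun _ _ => add_nonneg (Nat.cast_nonneg _) (Nat.cast_nonneg _))
      fun i hi => ?_
    exact_mod_cast card_image_inter_add_card_image_inter_le F (Finset.mem_filter.mp hi).2

/-- Log-concavity of `b ↦ 2 ^ b - 1` in the form of a supporting exponential at `m`. -/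
theorem two_pow_sub_one_mul_pow_le {m : ℕ} (hm : 1 ≤ m) (b : ℕ) :
    ((2 : ℝ) ^ b - 1) * (2 + 1 / ((2 : ℝ) ^ m - 1)) ^ m ≤
      ((2 : ℝ) ^ m - 1) * (2 + 1 / ((2 : ℝ) ^ m - 1)) ^ b := by
  have ha : (0 : ℝ) < 2 ^ m - 1 := sub_pos.mpr (one_lt_pow₀ one_lt_two (by omega))
  set r : ℝ := 2 + 1 / ((2 : ℝ) ^ m - 1) with hr
  have hr0 : 0 < r := by positivity
  have hinv : 1 / ((2 : ℝ) ^ m - 1) * ((2 : ℝ) ^ m - 1) = 1 := by field_simp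
  have hinv0 : 0 < 1 / ((2 : ℝ) ^ m - 1) := by positivity
  rcases le_total m b with hmb | hbm
  · induction b, hmb using Nat.le_induction with
    | base => exact le_rfl
    | succ b hmb ih =>
      have hle : (2 : ℝ) ^ m ≤ 2 ^ b := pow_le_pow_right₀ one_le_two hmb
      have step : (2 : ℝ) ^ (b + 1) - 1 ≤ ((2 : ℝ) ^ b - 1) * r := by
        rw [hr, pow_succ]
        nlinarith
      calc ((2 : ℝ) ^ (b + 1) - 1) * r ^ m ≤ (((2 : ℝ) ^ b - 1) * r) * r ^ m := by gcongr
        _ = (((2 : ℝ) ^ b - 1) * r ^ m) * r := by ring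
        _ ≤ (((2 : ℝ) ^ m - 1) * r ^ b) * r := by gcongr
        _ = _ := by ring
  · induction hbm using Nat.decreasingInduction with
    | self => exact le_rfl
    | of_succ b hbm ih =>
      have hle : (2 : ℝ) ^ b ≤ 2 ^ m := pow_le_pow_right₀ one_le_two hbm.le
      have step : ((2 : ℝ) ^ b - 1) * r ≤ (2 : ℝ) ^ (b + 1) - 1 := by
        rw [hr, pow_succ]
        nlinarith
      refine le_of_mul_le_mul_right ?_ hr0
      calc ((2 : ℝ) ^ b - 1) * r ^ m * r = (((2 : ℝ) ^ b - 1) * r) * r ^ m := by ring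
        _ ≤ ((2 : ℝ) ^ (b + 1) - 1) * r ^ m := by gcongr
        _ ≤ ((2 : ℝ) ^ m - 1) * r ^ (b + 1) := ih
        _ = _ := by ring

/-- If the average of the exponents `b i` is `m`, then the product of the numbers `2 ^ b i - 1` is
at most its value for constant exponents. -/
theorem prod_two_pow_sub_one_le {ι : Type*} [Fintype ι] {m : ℕ} (hm : 1 ≤ m) (b : ι → ℕ)
    (hb : ∑ i, b i = Fintype.card ι * m) :
    ∏ i, ((2 : ℝ) ^ b i - 1) ≤ ((2 : ℝ) ^ m - 1) ^ Fintype.card ι := by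
  have ha : (0 : ℝ) < 2 ^ m - 1 := sub_pos.mpr (one_lt_pow₀ one_lt_two (by omega))
  have h := Finset.prod_le_prod (s := Finset.univ) (fun i _ => mul_nonneg
    (sub_nonneg.mpr (one_le_pow₀ one_le_two)) (by positivity))
    fun i _ => two_pow_sub_one_mul_pow_le hm (b i)
  rw [Finset.prod_mul_distrib, Finset.prod_mul_distrib, Finset.prod_pow_eq_pow_sum,
    Finset.prod_pow_eq_pow_sum, hb, Finset.sum_const, Finset.prod_const, smul_eq_mul,
    Finset.card_univ] at h
  exact le_of_mul_le_mul_right h (by positivity)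

/-- Every state of a cycle with at least two states has a predecessor in the cycle other than
itself. -/
theorem exists_pred_mem_infOcc {S X : Type*} [Finite S] (f : S → X → S) (init : S) (ξ : ℕ → X)
    (hc : 2 ≤ (infOcc f init ξ).ncard) {q : S} (hq : q ∈ infOcc f init ξ) :
    ∃ r ∈ infOcc f init ξ, r ≠ q ∧ ∃ x, f r x = q := by
  obtain ⟨p, hp, hpq⟩ := Set.exists_ne_of_one_lt_ncard (a := q) hc
  have hfreq : ∃ᶠ n in Filter.atTop, ∃ r, run f init ξ n = r ∧ r ≠ q ∧ ∃ x, f r x = q := by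
    refine Filter.frequently_atTop.mpr fun N => ?_
    obtain ⟨n₁, hn₁, hN⟩ := hp.exists_gt N
    obtain ⟨n₂, hn₂, hlt⟩ := hq.exists_gt n₁
    have hex : ∃ k, run f init ξ (n₁ + k) = q := ⟨n₂ - n₁, by
      rwa [Nat.add_sub_cancel' hlt.le]⟩
    classical
    obtain ⟨k, hk⟩ : ∃ k, Nat.find hex = k + 1 := Nat.exists_eq_succ_of_ne_zero fun h0 => by
      have := Nat.find_spec hex
      rw [h0] at this
      exact hpq (hn₁.symm.trans this)
    refine ⟨n₁ + k, by omega, _, rfl, Nat.find_min hex (by omega), ξ (n₁ + k), ?_⟩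
    have := Nat.find_spec hex
    rwa [hk] at this
  obtain ⟨r, hr⟩ := Filter.frequently_exists.mp hfreq
  obtain ⟨n, -, hne, hx⟩ := hr.exists
  exact ⟨r, Nat.frequently_atTop_iff_infinite.mp (hr.mono fun _ h => h.1), hne, hx⟩

/-- For a deterministic automaton with `n` states over an alphabet
of size `d ≥ 1`, if `n ≥ d + 1` then the number of cycles of cardinality at least
2 is at most `(2^(d+1) − 1)^(n/(d+1))`. -/
theorem stmt_16 {S X : Type*} [Fintype S] [Nonempty S] [Fintype X]
    (f : S → X → S) (init : S) (hd : 1 ≤ Fintype.card X)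
    (hn : Fintype.card X + 1 ≤ Fintype.card S) :
    (({c ∈ cycles f init | 2 ≤ c.ncard}).ncard : ℝ) ≤
      ((2 : ℝ) ^ (Fintype.card X + 1) - 1) ^
        ((Fintype.card S : ℝ) / ((Fintype.card X : ℝ) + 1)) := by
  classical
  set d := Fintype.card X
  have hout : ∀ p : S, ∃ T : Finset S,
      insert p (Finset.univ.image (f p)) ⊆ T ∧ T.card = d + 1 := fun p =>
    Finset.exists_superset_card_eq
      ((Finset.card_insert_le _ _).trans (Nat.succ_le_succ Finset.card_image_le)) hn
  choose T hT hTcard using hout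
  set B : S → Finset S := fun q => Finset.univ.filter fun p => q ∈ T p with hB
  have hcover : ∀ p : S, (Finset.univ.filter fun q => p ∈ B q).card = d + 1 := fun p => by
    simp [hB, hTcard]
  set F : Finset (Finset S) :=
    Finset.univ.filter fun c => (c : Set S) ∈ cycles f init ∧ 2 ≤ c.card with hF
  have hcount : {c ∈ cycles f init | 2 ≤ c.ncard}.ncard = F.card := by
    rw [← Set.ncard_coe_finset, ← Set.ncard_image_of_injective _ Finset.coe_injective]
    congr 1
    ext c
    simp only [hF, Set.mem_ofPred_eq, Set.mem_image, Finset.coe_filter, Finset.mem_univ, true_and]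
    constructor
    · intro h
      refine ⟨c.toFinite.toFinset, ?_, c.toFinite.coe_toFinset⟩
      rwa [c.toFinite.coe_toFinset, ← Set.ncard_eq_toFinset_card c]
    · rintro ⟨c, h, rfl⟩
      rwa [Set.ncard_coe_finset]
  have htrace : ∀ q, ((F.image (· ∩ B q)).card : ℝ) ≤ (2 : ℝ) ^ (B q).card - 1 := by
    intro q
    have hqB : q ∈ B q := by
      simpa [hB] using hT q (Finset.mem_insert_self _ _)
    have hsub : F.image (· ∩ B q) ⊆ (B q).powerset.erase {q} := by
      intro t ht
      obtain ⟨c, hc, rfl⟩ := Finset.mem_image.mp ht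
      obtain ⟨⟨ξ, hξ⟩, h2⟩ := (Finset.mem_filter.mp hc).2
      refine Finset.mem_erase.mpr ⟨fun heq => ?_, Finset.mem_powerset.mpr Finset.inter_subset_right⟩
      have hqc : q ∈ c := (Finset.mem_inter.mp (heq ▸ Finset.mem_singleton_self q)).1
      obtain ⟨r, hr, hrq, x, hx⟩ := exists_pred_mem_infOcc f init ξ
        (by rwa [hξ, Set.ncard_coe_finset]) (q := q) (by rw [hξ]; exact hqc)
      rw [hξ] at hr
      have hrB : r ∈ B q := by
        simpa [hB] using hT r (Finset.mem_insert_of_mem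
          (Finset.mem_image.mpr ⟨x, Finset.mem_univ x, hx⟩))
      exact hrq (Finset.mem_singleton.mp (heq ▸ Finset.mem_inter.mpr ⟨hr, hrB⟩))
    have hle := Finset.card_le_card hsub
    rw [Finset.card_erase_of_mem (by simpa using hqB), Finset.card_powerset] at hle
    have hle' : (F.image (· ∩ B q)).card + 1 ≤ 2 ^ (B q).card := by
      have := Nat.one_le_two_pow (n := (B q).card)
      omega
    exact le_sub_iff_add_le.mpr (by exact_mod_cast hle')
  have hsum : ∑ q, (B q).card = Fintype.card S * (d + 1) := by
    have h := Finset.sum_card_bipartiteAbove_eq_sum_card_bipartiteBelow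
      (s := Finset.univ) (t := Finset.univ) fun (q p : S) => p ∈ B q
    simp only [Finset.bipartiteAbove, Finset.bipartiteBelow, hcover, Finset.sum_const,
      Finset.filter_univ_mem, Finset.card_univ, smul_eq_mul] at h
    exact h
  have hpow : (F.card : ℝ) ^ (d + 1) ≤ ((2 : ℝ) ^ (d + 1) - 1) ^ Fintype.card S :=
    calc (F.card : ℝ) ^ (d + 1) ≤ ∏ q, ((F.image (· ∩ B q)).card : ℝ) :=
          card_pow_le_prod_card_image_inter B d.succ_ne_zero Finset.univ (fun p _ => hcover p) F
            fun c _ => Finset.subset_univ c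
      _ ≤ ∏ q, ((2 : ℝ) ^ (B q).card - 1) :=
          Finset.prod_le_prod (fun _ _ => Nat.cast_nonneg _) fun q _ => htrace q
      _ ≤ _ := prod_two_pow_sub_one_le (Nat.le_add_left 1 d) _ hsum
  have hbase : (0 : ℝ) ≤ 2 ^ (d + 1) - 1 := sub_nonneg.mpr (one_le_pow₀ one_le_two)
  rw [hcount]
  refine le_of_pow_le_pow_left₀ d.succ_ne_zero (Real.rpow_nonneg hbase _) ?_
  rw [← Real.rpow_mul_natCast hbase, Nat.cast_succ, div_mul_cancel₀ _ (by positivity),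
    Real.rpow_natCast]
  exact hpow
end
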